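/- (Corollary 4) For any binary linear block code with minimum Hamming distance d_min transmitted with BPSK over an AWGN channel with noise variance σ², every decoder ψ satisfies BER_ψ ≥ (1/k) Q(√d_min / σ). -/

import Mathlib

open MeasureTheory ProbabilityTheory

/-- The Gaussian tail function `Q(x) = ∫_x^∞ (1/√(2π)) e^{-t²/2} dt`. -/
noncomputable def Qfun (x : ℝ) : ℝ :=
  ∫ t in Set.Ioi x, (1 / Real.sqrt (2 * Real.pi)) * Real.exp (-(t ^ 2) / 2)

/-- BPSK modulation: bit `b ↦ (-1)^b`. -/
noncomputable def bpsk (b : ZMod 2) : ℝ := if b = 0 then 1 else -1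

open scoped ENNReal NNReal

lemma Qfun_eq_gaussianReal (x : ℝ) : Qfun x = (gaussianReal 0 1).real (Set.Ioi x) := by
  rw [measureReal_def, gaussianReal_apply_eq_integral _ one_ne_zero, ENNReal.toReal_ofReal
    (integral_nonneg fun t => gaussianPDFReal_nonneg _ _ _), Qfun]
  simp [gaussianPDFReal]

lemma gaussianReal_Ioi_eq_Qfun {s : ℝ} (hs : 0 < s) (v : ℝ≥0) (hv : (v : ℝ) = s ^ 2) (r : ℝ) :
    (gaussianReal 0 v).real (Set.Ioi r) = Qfun (r / s) := by
  have hmap : gaussianReal 0 v = (gaussianReal 0 1).map (s * ·) := by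
    rw [gaussianReal_map_const_mul, mul_zero, mul_one]
    congr 1
    exact NNReal.coe_injective hv
  rw [hmap, map_measureReal_apply (by fun_prop) measurableSet_Ioi, Qfun_eq_gaussianReal]
  congr 1
  ext t
  simp [div_lt_iff₀' hs]

lemma gaussianReal_Iic_neg {v : ℝ≥0} (hv : v ≠ 0) (r : ℝ) :
    (gaussianReal 0 v).real (Set.Iic (-r)) = (gaussianReal 0 v).real (Set.Ioi r) := by
  have : NullSingletonClass (gaussianReal 0 v) := nullSingletonClass_gaussianReal hv
  conv_lhs => rw [← neg_zero, ← gaussianReal_map_neg,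
    map_measureReal_apply (by fun_prop) measurableSet_Iic]
  rw [measureReal_congr (Ioi_ae_eq_Ici (μ := gaussianReal 0 v) (a := r))]
  congr 1
  ext t
  simp

/-- The law of a linear functional of i.i.d. centered Gaussians. -/
lemma pi_gaussianReal_map_sum_mul {ι : Type*} [Fintype ι] (v w : ℝ≥0) (c : ι → ℝ)
    (hw : (w : ℝ) = (∑ j, c j ^ 2) * v) :
    (Measure.pi fun _ : ι => gaussianReal 0 v).map (fun z => ∑ j, z j * c j) =
      gaussianReal 0 w := by
  have hm : Measurable fun z : ι → ℝ => ∑ j, z j * c j := by fun_prop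
  have : IsProbabilityMeasure
      ((Measure.pi fun _ : ι => gaussianReal 0 v).map (fun z => ∑ j, z j * c j)) :=
    Measure.isProbabilityMeasure_map hm.aemeasurable
  apply Measure.ext_of_charFun
  ext t
  rw [charFun_apply_real, integral_map hm.aemeasurable (by fun_prop)]
  have hprod (z : ι → ℝ) : Complex.exp (t * ((∑ j, z j * c j : ℝ) : ℂ) * Complex.I) =
      ∏ j, Complex.exp (((t * c j : ℝ) : ℂ) * (z j : ℂ) * Complex.I) := by
    rw [← Complex.exp_sum]
    congr 1
    push_cast
    rw [Finset.mul_sum, Finset.sum_mul]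
    exact Finset.sum_congr rfl fun j _ => by ring
  simp_rw [hprod]
  rw [integral_fintype_prod_eq_prod
    (fun j (x : ℝ) => Complex.exp (((t * c j : ℝ) : ℂ) * (x : ℂ) * Complex.I))]
  simp_rw [← charFun_apply_real, charFun_gaussianReal]
  rw [← Complex.exp_sum]
  congr 1
  have hw' : (w : ℂ) = (∑ j, (c j : ℂ) ^ 2) * v := by exact_mod_cast hw
  rw [hw']
  simp only [Complex.ofReal_zero, mul_zero, zero_mul, zero_sub, Finset.sum_neg_distrib,
    Finset.sum_mul, Finset.sum_div]
  congr 1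
  exact Finset.sum_congr rfl fun j _ => by push_cast; ring

/-- The density of a shifted Gaussian with respect to the centered one. -/
noncomputable def gaussianShiftDensity (v : ℝ≥0) (c x : ℝ) : ℝ≥0∞ :=
  ENNReal.ofReal (Real.exp ((x * c - c ^ 2 / 2) / v))

lemma measurable_gaussianShiftDensity (v : ℝ≥0) (c : ℝ) :
    Measurable (gaussianShiftDensity v c) := by
  unfold gaussianShiftDensity
  fun_prop

lemma gaussianReal_withDensity_shift {v : ℝ≥0} (hv : v ≠ 0) (c : ℝ) :
    (gaussianReal 0 v).withDensity (gaussianShiftDensity v c) = gaussianReal c v := by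
  rw [gaussianReal_of_var_ne_zero _ hv, gaussianReal_of_var_ne_zero _ hv,
    ← withDensity_mul _ (measurable_gaussianPDF _ _) (measurable_gaussianShiftDensity _ _)]
  congr 1
  ext x
  have hv' : (v : ℝ) ≠ 0 := by exact_mod_cast hv
  rw [Pi.mul_apply, gaussianPDF, gaussianPDF, gaussianShiftDensity,
    ← ENNReal.ofReal_mul (gaussianPDFReal_nonneg _ _ _), gaussianPDFReal, gaussianPDFReal,
    mul_assoc, ← Real.exp_add]
  congr 3
  field_simp
  ring

/-- The Cameron–Martin formula for i.i.d. Gaussians. -/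
lemma pi_gaussianReal_map_add {ι : Type*} [Fintype ι] {v : ℝ≥0} (hv : v ≠ 0) (c : ι → ℝ) :
    (Measure.pi fun _ : ι => gaussianReal 0 v).map (fun z j => z j + c j) =
      (Measure.pi fun _ : ι => gaussianReal 0 v).withDensity
        (fun z => ∏ j, gaussianShiftDensity v (c j) (z j)) := by
  have (j : ι) : IsProbabilityMeasure ((gaussianReal 0 v).map (· + c j)) :=
    Measure.isProbabilityMeasure_map (by fun_prop)
  rw [Measure.pi_map_pi (f := fun j x => x + c j) (fun j => by fun_prop)]
  refine Measure.pi_eq fun s hs => ?_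
  have hmeas (j : ι) : Measurable ((s j).indicator (gaussianShiftDensity v (c j))) :=
    (measurable_gaussianShiftDensity v (c j)).indicator (hs j)
  have hind (z : ι → ℝ) :
      (Set.univ.pi s).indicator (fun z => ∏ j, gaussianShiftDensity v (c j) (z j)) z =
        ∏ j, (s j).indicator (gaussianShiftDensity v (c j)) (z j) := by
    by_cases hz : z ∈ Set.univ.pi s
    · rw [Set.indicator_of_mem hz]
      exact Finset.prod_congr rfl fun j _ => (Set.indicator_of_mem (hz j trivial) _).symm
    · rw [Set.indicator_of_notMem hz]
      obtain ⟨j, hj⟩ : ∃ j, z j ∉ s j := by simpa using hz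
      exact (Finset.prod_eq_zero (Finset.mem_univ j) (Set.indicator_of_notMem hj _)).symm
  rw [withDensity_apply _ (.univ_pi hs), ← lintegral_indicator (.univ_pi hs)]
  simp_rw [hind]
  rw [lintegral_prod_eq_prod_lintegral_of_indepFun Finset.univ
    (fun j (z : ι → ℝ) => (s j).indicator (gaussianShiftDensity v (c j)) (z j))
    (iIndepFun_pi fun j => (hmeas j).aemeasurable)
    (fun j => (hmeas j).comp (measurable_pi_apply j))]
  refine Finset.prod_congr rfl fun j _ => ?_
  rw [(measurePreserving_eval _ j).lintegral_comp (hmeas j), lintegral_indicator (hs j),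
    ← withDensity_apply _ (hs j), gaussianReal_withDensity_shift hv, gaussianReal_map_add_const, zero_add]

/-- The likelihood-ratio test minimizes the sum of the two error probabilities. -/
lemma measure_add_measure_compl_le {α : Type*} [MeasurableSpace α] {μ ν : Measure α}
    {H A : Set α} (hH : MeasurableSet H) (hA : MeasurableSet A)
    (hle : ∀ S, MeasurableSet S → S ⊆ H → μ S ≤ ν S)
    (hge : ∀ S, MeasurableSet S → S ⊆ Hᶜ → ν S ≤ μ S) :
    μ H + ν Hᶜ ≤ μ A + ν Aᶜ := by
  rw [← measure_inter_add_sdiff H hA, ← measure_inter_add_sdiff Hᶜ hA,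
    ← measure_inter_add_sdiff A hH, ← measure_inter_add_sdiff Aᶜ hH]
  have h₁ := hle (H \ A) (hH.diff hA) Set.sdiff_subset
  have h₂ := hge (Hᶜ ∩ A) (hH.compl.inter hA) Set.inter_subset_left
  have e₁ : A \ H = Hᶜ ∩ A := by ext; simp [and_comm]
  have e₂ : Aᶜ ∩ H = H \ A := by ext; simp [and_comm]
  have e₃ : Aᶜ \ H = Hᶜ \ A := by ext; simp [and_comm]
  rw [e₁, e₂, e₃, Set.inter_comm A H]
  calc _ ≤ μ (H ∩ A) + ν (H \ A) + (μ (Hᶜ ∩ A) + ν (Hᶜ \ A)) := by gcongr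
    _ = _ := by ring

/-- Lower bound on the sum of the error probabilities of a test between two Gaussians
with the same isotropic covariance whose means differ by `c`. -/
lemma two_mul_Qfun_le_test_error {ι : Type*} [Fintype ι] {σ : ℝ} (hσ : 0 < σ) {v : ℝ≥0}
    (hv : (v : ℝ) = σ ^ 2) (c : ι → ℝ) (hc : 0 < ∑ j, c j ^ 2)
    {A : Set (ι → ℝ)} (hA : MeasurableSet A) :
    2 * Qfun (Real.sqrt (∑ j, c j ^ 2) / (2 * σ)) ≤
      (Measure.pi fun _ : ι => gaussianReal 0 v).real A +
        (Measure.pi fun _ : ι => gaussianReal 0 v).real {z | (fun j => z j + c j) ∈ Aᶜ} := by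
  have hv0 : v ≠ 0 := by
    rintro rfl
    exact (pow_pos hσ 2).ne hv
  set γ := Measure.pi fun _ : ι => gaussianReal 0 v with hγ
  set r := ∑ j, c j ^ 2 with hr
  set ν := γ.map (fun z j => z j + c j) with hν
  have : IsProbabilityMeasure ν := Measure.isProbabilityMeasure_map
    (by fun_prop : Measurable fun (z : ι → ℝ) j => z j + c j).aemeasurable
  set L : (ι → ℝ) → ℝ := fun z => ∑ j, z j * c j with hL
  have hLm : Measurable L := by fun_prop
  set H := L ⁻¹' Set.Ioi (r / 2) with hHdef
  have hH : MeasurableSet H := hLm measurableSet_Ioi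
  set w : ℝ≥0 := ⟨r * σ ^ 2, by positivity⟩ with hw
  have hlaw : γ.map L = gaussianReal 0 w :=
    pi_gaussianReal_map_sum_mul v w c (by rw [hv]; rfl)
  have hw0 : w ≠ 0 := by
    rw [← NNReal.coe_ne_zero]
    exact (by positivity : r * σ ^ 2 ≠ 0)
  have hs : 0 < Real.sqrt r * σ := by positivity
  have hQ : (gaussianReal 0 w).real (Set.Ioi (r / 2)) = Qfun (Real.sqrt r / (2 * σ)) := by
    rw [gaussianReal_Ioi_eq_Qfun hs w (by rw [mul_pow, Real.sq_sqrt hc.le]; rfl)]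
    congr 1
    have := Real.sq_sqrt hc.le
    field_simp
    exact this.symm
  have hμH : γ.real H = Qfun (Real.sqrt r / (2 * σ)) := by
    rw [hHdef, ← map_measureReal_apply hLm measurableSet_Ioi, hlaw, hQ]
  have hνH : ν.real Hᶜ = Qfun (Real.sqrt r / (2 * σ)) := by
    rw [hν, map_measureReal_apply (by fun_prop) hH.compl, ← hQ, ← gaussianReal_Iic_neg hw0,
      ← hlaw, map_measureReal_apply hLm measurableSet_Iic]
    congr 1
    ext z
    have : L (fun j => z j + c j) = L z + r := by
      simp only [hL, hr, ← Finset.sum_add_distrib]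
      exact Finset.sum_congr rfl fun j _ => by ring
    simp only [hHdef, Set.mem_preimage, Set.mem_compl_iff, Set.mem_Ioi, Set.mem_Iic, not_lt, this]
    constructor <;> intro h <;> linarith
  have hdens (z : ι → ℝ) : ∏ j, gaussianShiftDensity v (c j) (z j) =
      ENNReal.ofReal (Real.exp ((L z - r / 2) / v)) := by
    simp only [gaussianShiftDensity]
    rw [← ENNReal.ofReal_prod_of_nonneg fun _ _ => (Real.exp_pos _).le, ← Real.exp_sum,
      ← Finset.sum_div, Finset.sum_sub_distrib, ← Finset.sum_div]
  have hνd (S : Set (ι → ℝ)) (hS : MeasurableSet S) :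
      ν S = ∫⁻ z in S, ENNReal.ofReal (Real.exp ((L z - r / 2) / v)) ∂γ := by
    rw [hν, hγ, pi_gaussianReal_map_add hv0, withDensity_apply _ hS]
    simp_rw [hdens]
  have key : γ H + ν Hᶜ ≤ γ A + ν Aᶜ := by
    refine measure_add_measure_compl_le hH hA (fun S hS hSH => ?_) (fun S hS hSH => ?_)
    · rw [hνd S hS, ← setLIntegral_one]
      refine setLIntegral_mono' hS fun z hz => ?_
      rw [ENNReal.one_le_ofReal, Real.one_le_exp_iff]
      exact div_nonneg (sub_nonneg.2 (le_of_lt (hSH hz))) v.2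
    · rw [hνd S hS, ← setLIntegral_one]
      refine setLIntegral_mono' hS fun z hz => ?_
      rw [ENNReal.ofReal_le_one, Real.exp_le_one_iff]
      exact div_nonpos_of_nonpos_of_nonneg (sub_nonpos.2 (not_lt.1 (hSH hz))) v.2
  have key' : γ.real H + ν.real Hᶜ ≤ γ.real A + ν.real Aᶜ := by
    have := ENNReal.toReal_mono (by finiteness) key
    rwa [ENNReal.toReal_add (by finiteness) (by finiteness),
      ENNReal.toReal_add (by finiteness) (by finiteness)] at this
  rw [hμH, hνH, hν, map_measureReal_apply (by fun_prop) hA.compl] at key'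
  rw [two_mul]
  exact key'

lemma uniformOfFintype_prod_real {α β : Type*} [Fintype α] [Nonempty α] [MeasurableSpace α]
    [MeasurableSingletonClass α] [MeasurableSpace β] (γ : Measure β) [IsProbabilityMeasure γ]
    {S : Set (α × β)} (hS : MeasurableSet S) :
    (((PMF.uniformOfFintype α).toMeasure).prod γ).real S =
      (Fintype.card α : ℝ)⁻¹ * ∑ a, γ.real (Prod.mk a ⁻¹' S) := by
  rw [measureReal_def, Measure.prod_apply hS, lintegral_fintype,
    ENNReal.toReal_sum (fun a _ => by finiteness), Finset.mul_sum]
  refine Finset.sum_congr rfl fun a _ => ?_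
  rw [PMF.toMeasure_apply_singleton _ _ (measurableSet_singleton a), ENNReal.toReal_mul,
    mul_comm]
  simp [measureReal_def]

lemma sum_sq_bpsk_add_sub {ι : Type*} [Fintype ι] (x y : ι → ZMod 2) :
    ∑ j, (bpsk ((x + y) j) - bpsk (x j)) ^ 2 = 4 * (hammingNorm y : ℝ) := by
  have h (j : ι) : (bpsk ((x + y) j) - bpsk (x j)) ^ 2 = if y j ≠ 0 then 4 else 0 := by
    rw [Pi.add_apply]
    generalize x j = a
    generalize y j = b
    have h01 (a : ZMod 2) : a = 0 ∨ a = 1 := by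
      revert a
      decide
    have h11 : (1 + 1 : ZMod 2) = 0 := rfl
    have hb0 : bpsk 0 = 1 := if_pos rfl
    have hb1 : bpsk 1 = -1 := if_neg one_ne_zero
    rcases h01 a with rfl | rfl <;> rcases h01 b with rfl | rfl <;>
      simp only [add_zero, zero_add, h11, hb0, hb1] <;> norm_num
  simp_rw [h, Finset.sum_ite, hammingNorm]
  simp [mul_comm]

lemma ZMod.ne_add_iff_eq_of_ne_zero {a b c : ZMod 2} (hc : c ≠ 0) : a ≠ b + c ↔ a = b := by
  revert a b c
  decide

/-- (Corollary 4) For any binary linear block code with minimum Hamming distance `d_min`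
transmitted with BPSK over an AWGN channel with noise variance `σ²`, every (measurable)
decoder `ψ` satisfies `BER_ψ ≥ (1/k) Q(√d_min / σ)`. -/
theorem ber_lower_bound_dmin
    (n k : ℕ) (hk : 1 ≤ k) (hkn : k ≤ n) (σ : ℝ) (hσ : 0 < σ)
    -- generator matrix of rank `k`, i.e. with linearly independent rows
    (G : Matrix (Fin k) (Fin n) (ZMod 2))
    (hG : LinearIndependent (ZMod 2) (fun i => G i))
    -- `d_min` is the minimum Hamming weight over the nonzero codewords
    (dmin : ℕ)
    (hdmin : IsLeast {w : ℕ | ∃ u : Fin k → ZMod 2, u ≠ 0 ∧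
        hammingNorm (Matrix.vecMul u G) = w} dmin)
    -- the underlying probability measure: `U` uniform, independent i.i.d. Gaussian noise
    (P : Measure ((Fin k → ZMod 2) × (Fin n → ℝ)))
    (hP : P = ((PMF.uniformOfFintype (Fin k → ZMod 2)).toMeasure).prod
        (Measure.pi fun _ : Fin n => gaussianReal 0 ((σ ^ 2).toNNReal)))
    -- the received vector `Y_j = (-1)^{(UG)_j} + Z_j`
    (Y : (Fin k → ZMod 2) × (Fin n → ℝ) → Fin n → ℝ)
    (hY : Y = fun ω j => bpsk (Matrix.vecMul ω.1 G j) + ω.2 j)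
    -- the decoder and its bit-error probability
    (ψ : (Fin n → ℝ) → Fin k → ZMod 2) (hψ : Measurable ψ)
    (BER : ℝ)
    (hBER : BER = (1 / (k : ℝ)) * ∑ i : Fin k, (P {ω | ψ (Y ω) i ≠ ω.1 i}).toReal) :
    (1 / (k : ℝ)) * Qfun (Real.sqrt (dmin : ℝ) / σ) ≤ BER := by
  have hσ2 : ((σ ^ 2).toNNReal : ℝ) = σ ^ 2 := Real.coe_toNNReal _ (sq_nonneg σ)
  obtain ⟨⟨u₀, hu₀, hw⟩, -⟩ := hdmin
  obtain ⟨i, hi⟩ : ∃ i, u₀ i ≠ 0 := Function.ne_iff.1 hu₀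
  set γ := Measure.pi fun _ : Fin n => gaussianReal 0 ((σ ^ 2).toNNReal) with hγ
  have hdpos : 0 < (dmin : ℝ) := by
    have hinj : Function.Injective fun u => Matrix.vecMul u G := Matrix.vecMul_injective_iff.2 hG
    rw [← hw, Nat.cast_pos, hammingNorm_pos_iff]
    intro h
    exact hu₀ (hinj (by simpa using h))
  set E : (Fin k → ZMod 2) → ℝ := fun u =>
    γ.real {z | ψ (fun j => bpsk (Matrix.vecMul u G j) + z j) i ≠ u i} with hE
  have hpair (u : Fin k → ZMod 2) : 2 * Qfun (Real.sqrt dmin / σ) ≤ E u + E (u + u₀) := by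
    set c : Fin n → ℝ := fun j =>
      bpsk (Matrix.vecMul (u + u₀) G j) - bpsk (Matrix.vecMul u G j) with hc
    have hcsum : ∑ j, c j ^ 2 = 4 * (dmin : ℝ) := by
      simp only [hc, Matrix.add_vecMul]
      rw [sum_sq_bpsk_add_sub, hw]
    have hA : MeasurableSet
        {z : Fin n → ℝ | ψ (fun j => bpsk (Matrix.vecMul u G j) + z j) i ≠ u i} :=
      (measurableSet_eq_fun ((measurable_pi_apply i).comp (hψ.comp (by fun_prop)))
        measurable_const).compl
    have h := two_mul_Qfun_le_test_error hσ hσ2 c (by rw [hcsum]; positivity) hA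
    have hsqrt : Real.sqrt (∑ j, c j ^ 2) / (2 * σ) = Real.sqrt dmin / σ := by
      rw [hcsum, Real.sqrt_mul (by norm_num), show (4 : ℝ) = 2 ^ 2 by norm_num,
        Real.sqrt_sq (by norm_num), mul_div_mul_left _ _ two_ne_zero]
    rw [hsqrt] at h
    convert h using 3
    ext z
    have hz : (fun j => bpsk (Matrix.vecMul u G j) + (z j + c j)) =
        fun j => bpsk (Matrix.vecMul (u + u₀) G j) + z j := by
      ext j
      simp only [hc]
      ring
    simp only [Set.mem_ofPred_eq, Set.mem_compl_iff, not_not, hz, Pi.add_apply]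
    exact ZMod.ne_add_iff_eq_of_ne_zero hi
  have hYm : Measurable Y := by
    rw [hY]
    refine measurable_pi_lambda _ fun j => Measurable.add ?_ (by fun_prop)
    exact (measurable_of_finite fun u : Fin k → ZMod 2 => bpsk (Matrix.vecMul u G j)).comp
      measurable_fst
  have hS : MeasurableSet {ω | ψ (Y ω) i ≠ ω.1 i} :=
    (measurableSet_eq_fun ((measurable_pi_apply i).comp (hψ.comp hYm))
      ((measurable_pi_apply i).comp measurable_fst)).compl
  have hPi : (P {ω | ψ (Y ω) i ≠ ω.1 i}).toReal =
      (Fintype.card (Fin k → ZMod 2) : ℝ)⁻¹ * ∑ u, E u := by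
    rw [← measureReal_def, hP, uniformOfFintype_prod_real γ hS, hY]
    rfl
  have hshift : ∑ u, E (u + u₀) = ∑ u, E u := Equiv.sum_comp (Equiv.addRight u₀) E
  have hsum : (Fintype.card (Fin k → ZMod 2) : ℝ) * Qfun (Real.sqrt dmin / σ) ≤ ∑ u, E u := by
    have h := Finset.sum_le_sum fun u (_ : u ∈ Finset.univ) => hpair u
    rw [Finset.sum_add_distrib, hshift, Finset.sum_const, Finset.card_univ, nsmul_eq_mul] at h
    linarith
  rw [hBER]
  gcongr
  calc Qfun (Real.sqrt dmin / σ) ≤ (P {ω | ψ (Y ω) i ≠ ω.1 i}).toReal := by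
        rw [hPi, le_inv_mul_iff₀ (by positivity)]
        exact hsum
    _ ≤ _ := Finset.single_le_sum (f := fun i => (P {ω | ψ (Y ω) i ≠ ω.1 i}).toReal)
        (fun _ _ => ENNReal.toReal_nonneg) (Finset.mem_univ i)
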